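/- Let A_1, ..., A_k be pairwise commuting real antisymmetric N×N matrices. Then there exists L ∈ SO(N) such that for every i, L^T A_i L is block diagonal consisting of 2×2 blocks λ_{i,j} J_2 (with J_2 = [[0,1],[-1,0]] and λ_{i,j} real), followed by a single zero 1×1 block if N is odd. -/

import Mathlib

open Matrix

/-- A family of commuting skew-adjoint operators, one of which is nonzero, admits a common
invariant plane on which each of them acts as a multiple of the rotation by a right angle. -/
lemma exists_orthonormal_pair_of_commuting_skew {ι E : Type*} [NormedAddCommGroup E]
    [InnerProductSpace ℝ E] [FiniteDimensional ℝ E] (T : ι → E →ₗ[ℝ] E)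
    (hcomm : ∀ i j x, T i (T j x) = T j (T i x))
    (hskew : ∀ i x y, inner ℝ (T i x) y = -inner ℝ x (T i y)) (i₀ : ι) (h₀ : T i₀ ≠ 0) :
    ∃ u v : E, ‖u‖ = 1 ∧ ‖v‖ = 1 ∧ inner ℝ u v = 0 ∧
      ∀ i, ∃ c : ℝ, T i v = c • u ∧ T i u = -c • v := by
  have hself : ∀ i x, inner ℝ x (T i x) = 0 := fun i x => by
    have := hskew i x x
    rw [real_inner_comm] at this
    linarith
  have htop := LinearMap.IsSymmetric.iSup_iInf_eq_top_of_commute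
    (T := fun ij : ι × ι => T ij.1 ∘ₗ T ij.2)
    (fun ij x y => by
      simp only [LinearMap.comp_apply]
      rw [hskew, hskew, neg_neg, hcomm])
    (fun a b _ => by
      ext x
      simp only [Module.End.mul_apply, LinearMap.comp_apply]
      rw [hcomm a.2 b.1, hcomm a.1 b.1, hcomm a.2 b.2, hcomm a.1 b.2])
  obtain ⟨χ, x, hx, hx0⟩ : ∃ χ : ι × ι → ℝ, ∃ x, (∀ i j, T i (T j x) = χ (i, j) • x) ∧
      T i₀ x ≠ 0 := by
    by_contra! hcon
    apply h₀
    rw [← LinearMap.ker_eq_top, eq_top_iff, ← htop]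
    refine iSup_le fun χ x hx => ?_
    refine LinearMap.mem_ker.2 (hcon χ x fun i j => ?_)
    exact Module.End.mem_eigenspace_iff.1 ((Submodule.mem_iInf _).1 hx (i, j))
  have hxne : x ≠ 0 := by
    rintro rfl
    exact hx0 (map_zero _)
  have hμ : χ (i₀, i₀) ≠ 0 := by
    intro h
    have h1 := hskew i₀ x (T i₀ x)
    rw [hx, h, zero_smul, inner_zero_right, neg_zero, inner_self_eq_zero] at h1
    exact hx0 h1
  have hTx : ∀ i, T i x = (χ (i₀, i) / χ (i₀, i₀)) • T i₀ x := fun i => by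
    have h1 : χ (i₀, i₀) • T i x = χ (i₀, i) • T i₀ x := by
      rw [← map_smul, ← hx, hcomm i, hcomm i i₀ x, hx, map_smul]
    rw [div_eq_inv_mul, mul_smul, ← h1, smul_smul, inv_mul_cancel₀ hμ, one_smul]
  have hn : ‖x‖ ≠ 0 := norm_ne_zero_iff.2 hxne
  have hm : ‖T i₀ x‖ ≠ 0 := norm_ne_zero_iff.2 hx0
  have huv : inner ℝ (‖x‖⁻¹ • x) (‖T i₀ x‖⁻¹ • T i₀ x) = 0 := by
    rw [inner_smul_left, inner_smul_right, hself]
    simp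
  have hu : ‖‖x‖⁻¹ • x‖ = 1 := by rw [norm_smul, norm_inv, norm_norm, inv_mul_cancel₀ hn]
  have hv : ‖‖T i₀ x‖⁻¹ • T i₀ x‖ = 1 := by
    rw [norm_smul, norm_inv, norm_norm, inv_mul_cancel₀ hm]
  refine ⟨‖x‖⁻¹ • x, ‖T i₀ x‖⁻¹ • T i₀ x, hu, hv, huv, fun i => ?_⟩
  obtain ⟨c, hc⟩ : ∃ c : ℝ, T i (‖T i₀ x‖⁻¹ • T i₀ x) = c • (‖x‖⁻¹ • x) :=
    ⟨‖T i₀ x‖⁻¹ * χ (i, i₀) * ‖x‖, by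
      rw [map_smul, hx, smul_smul, smul_smul, mul_assoc (_ * _), mul_inv_cancel₀ hn, mul_one]⟩
  obtain ⟨d, hd⟩ : ∃ d : ℝ, T i (‖x‖⁻¹ • x) = d • (‖T i₀ x‖⁻¹ • T i₀ x) :=
    ⟨‖x‖⁻¹ * (χ (i₀, i) / χ (i₀, i₀)) * ‖T i₀ x‖, by
      rw [map_smul, hTx, smul_smul, smul_smul, mul_assoc (_ * _), mul_inv_cancel₀ hm, mul_one]⟩
  refine ⟨c, hc, ?_⟩
  have key : ∀ u v : E, ‖u‖ = 1 → ‖v‖ = 1 → T i v = c • u → T i u = d • v → d = -c := by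
    intro u v hu hv hc hd
    have h := hskew i u v
    rwa [hc, hd, real_inner_smul_left, real_inner_smul_right, real_inner_self_eq_norm_sq,
      real_inner_self_eq_norm_sq, hu, hv, one_pow, mul_one, mul_one] at h
  rw [hd, key _ _ hu hv hc hd]

/-- The entries of the antisymmetric block-diagonal matrix with `2 × 2` blocks `lam j • J₂`. -/
def skewBlockEntry (lam : ℕ → ℝ) (p q : ℕ) : ℝ :=
  if p % 2 = 0 ∧ q = p + 1 then lam (p / 2)
  else if p % 2 = 1 ∧ p = q + 1 then -lam (q / 2)
  else 0

lemma skewBlockEntry_add_two (lam : ℕ → ℝ) (p q : ℕ) :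
    skewBlockEntry lam (p + 2) (q + 2) = skewBlockEntry (fun j => lam (j + 1)) p q := by
  have h1 : (p + 2) / 2 = p / 2 + 1 := by omega
  have h2 : (q + 2) / 2 = q / 2 + 1 := by omega
  have h3 : (p + 2) % 2 = p % 2 := by omega
  have h4 : q + 2 = p + 2 + 1 ↔ q = p + 1 := by omega
  have h5 : p + 2 = q + 2 + 1 ↔ p = q + 1 := by omega
  simp only [skewBlockEntry, h1, h2, h3, h4, h5]

open Module in
/-- Commuting skew-adjoint operators are simultaneously block diagonal, with `2 × 2` blocks, in
some orthonormal basis. -/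
lemma exists_orthonormal_skewBlock {ι : Type*} (n : ℕ) : ∀ (E : Type*) [NormedAddCommGroup E]
    [InnerProductSpace ℝ E] [FiniteDimensional ℝ E] (_ : finrank ℝ E = n) (T : ι → E →ₗ[ℝ] E)
    (_ : ∀ i j x, T i (T j x) = T j (T i x))
    (_ : ∀ i x y, inner ℝ (T i x) y = -inner ℝ x (T i y)),
    ∃ b : Fin n → E, Orthonormal ℝ b ∧ ∀ i, ∃ lam : ℕ → ℝ, ∀ p q,
      inner ℝ (b p) (T i (b q)) = skewBlockEntry lam p q := by
  induction n using Nat.strong_induction_on with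
  | _ n ih =>
  intro E _ _ _ hE T hcomm hskew
  by_cases hT : ∀ i, T i = 0
  · subst hE
    exact ⟨stdOrthonormalBasis ℝ E, (stdOrthonormalBasis ℝ E).orthonormal,
      fun i => ⟨0, fun p q => by simp [hT, skewBlockEntry]⟩⟩
  push Not at hT
  obtain ⟨i₀, h₀⟩ := hT
  obtain ⟨u, v, hu, hv, huv, huvT⟩ :=
    exists_orthonormal_pair_of_commuting_skew T hcomm hskew i₀ h₀
  have hvu : inner ℝ v u = 0 := by rw [real_inner_comm, huv]
  have hpair : Orthonormal ℝ ![u, v] := by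
    rw [orthonormal_iff_ite]
    intro i j
    fin_cases i <;> fin_cases j <;> simp [hu, hv, huv, hvu]
  set W := Submodule.span ℝ (Set.range ![u, v]) with hW
  have hmem : ∀ w, w ∈ Wᗮ ↔ inner ℝ u w = 0 ∧ inner ℝ v w = 0 := fun w => by
    rw [hW, Submodule.mem_orthogonal]
    constructor
    · exact fun h => ⟨h u (Submodule.subset_span ⟨0, rfl⟩), h v (Submodule.subset_span ⟨1, rfl⟩)⟩
    · rintro ⟨h1, h2⟩ z hz
      induction hz using Submodule.span_induction with
      | mem z hz =>
        obtain ⟨i, rfl⟩ := hz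
        fin_cases i
        · exact h1
        · exact h2
      | zero => exact inner_zero_left _
      | add a b _ _ ha hb => rw [inner_add_left, ha, hb, add_zero]
      | smul c a _ ha => rw [inner_smul_left, ha, mul_zero]
  have hdim : 2 + finrank ℝ Wᗮ = n := by
    rw [← hE, ← Submodule.finrank_add_finrank_orthogonal W, hW,
      finrank_span_eq_card hpair.linearIndependent, Fintype.card_fin]
  have hinv : ∀ i, ∀ w ∈ Wᗮ, T i w ∈ Wᗮ := fun i w hw => by
    obtain ⟨c, hc1, hc2⟩ := huvT i
    rw [hmem] at hw ⊢
    have h1 := hskew i u w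
    have h2 := hskew i v w
    rw [hc2, real_inner_smul_left, hw.2] at h1
    rw [hc1, real_inner_smul_left, hw.1] at h2
    constructor <;> linarith
  obtain ⟨m, hm⟩ : ∃ m, finrank ℝ Wᗮ = m := ⟨_, rfl⟩
  obtain rfl : n = m + 2 := by omega
  obtain ⟨b, hb, hbT⟩ := ih m (by omega) Wᗮ hm (fun i => (T i).restrict (hinv i))
    (fun i j x => Subtype.ext (hcomm i j x)) (fun i x y => hskew i x y)
  have hbu : ∀ p, inner ℝ u (b p : E) = 0 := fun p => ((hmem _).1 (b p).2).1
  have hbv : ∀ p, inner ℝ v (b p : E) = 0 := fun p => ((hmem _).1 (b p).2).2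
  have hub : ∀ p, inner ℝ (b p : E) u = 0 := fun p => by rw [real_inner_comm, hbu]
  have hvb : ∀ p, inner ℝ (b p : E) v = 0 := fun p => by rw [real_inner_comm, hbv]
  have hbb : ∀ p q, inner ℝ (b p : E) (b q : E) = if p = q then (1 : ℝ) else 0 :=
    orthonormal_iff_ite.1 hb
  refine ⟨Fin.cons u (Fin.cons v fun p => (b p : E)), ?_, fun i => ?_⟩
  · rw [orthonormal_iff_ite]
    intro p q
    refine Fin.cases ?_ (Fin.cases ?_ fun p => ?_) p <;>
      refine Fin.cases ?_ (Fin.cases ?_ fun q => ?_) q <;>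
      simp [hu, hv, huv, hvu, hbu, hbv, hub, hvb, hbb, Fin.ext_iff]
  · obtain ⟨c, hc1, hc2⟩ := huvT i
    obtain ⟨lam, hlam⟩ := hbT i
    have hlam' : ∀ p q, inner ℝ (b p : E) (T i (b q)) = skewBlockEntry lam p q := hlam
    have hTu : ∀ p, inner ℝ u (T i (b p)) = 0 := fun p => ((hmem _).1 (hinv i _ (b p).2)).1
    have hTv : ∀ p, inner ℝ v (T i (b p)) = 0 := fun p => ((hmem _).1 (hinv i _ (b p).2)).2
    refine ⟨fun j => Nat.casesOn j c lam, fun p q => ?_⟩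
    refine Fin.cases ?_ (Fin.cases ?_ fun p => ?_) p <;>
      refine Fin.cases ?_ (Fin.cases ?_ fun q => ?_) q
    case refine_3.refine_3 =>
      simp [hlam', skewBlockEntry_add_two]
    all_goals
      simp [hc1, hc2, real_inner_smul_right, hu, hv, huv, hvu, hub, hvb, hTu,
        hTv, skewBlockEntry]
    intros
    omega

theorem stmt_15 (N k : ℕ) (A : Fin k → Matrix (Fin N) (Fin N) ℝ)
    (hcomm : ∀ i j, A i * A j = A j * A i)
    (hanti : ∀ i, (A i)ᵀ = -(A i)) :
    ∃ L ∈ Matrix.orthogonalGroup (Fin N) ℝ, L.det = 1 ∧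
      ∀ i, ∃ lam : ℕ → ℝ,
        Lᵀ * A i * L = Matrix.of fun p q : Fin N =>
          if (p : ℕ) % 2 = 0 ∧ (q : ℕ) = (p : ℕ) + 1 then lam ((p : ℕ) / 2)
          else if (p : ℕ) % 2 = 1 ∧ (p : ℕ) = (q : ℕ) + 1 then -lam ((q : ℕ) / 2)
          else 0 := by
  have hinner : ∀ x y : EuclideanSpace ℝ (Fin N), inner ℝ x y = x.ofLp ⬝ᵥ y.ofLp := fun x y => by
    rw [EuclideanSpace.inner_eq_star_dotProduct, star_trivial, dotProduct_comm]
  obtain ⟨b, hb, hbT⟩ := exists_orthonormal_skewBlock N (EuclideanSpace ℝ (Fin N)) (by simp)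
    (fun i => Matrix.toEuclideanLin (A i))
    (fun i j x => by
      apply WithLp.ofLp_injective
      simp [Matrix.toLpLin_apply, Matrix.mulVec_mulVec, hcomm i j])
    (fun i x y => by
      rw [hinner, hinner]
      simp only [Matrix.ofLp_toLpLin, Matrix.toLin'_apply]
      rw [dotProduct_comm, dotProduct_mulVec, ← mulVec_transpose, hanti, neg_mulVec,
        neg_dotProduct, dotProduct_comm])
  let L : Matrix (Fin N) (Fin N) ℝ := Matrix.of fun p q => (b q).ofLp p
  have hLL : Lᵀ * L = 1 := by
    ext p q
    have h := orthonormal_iff_ite.1 hb p q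
    rw [hinner] at h
    rw [Matrix.one_apply, ← h]
    rfl
  have hLA : ∀ i, ∃ lam : ℕ → ℝ, ∀ p q, (Lᵀ * A i * L) p q = skewBlockEntry lam p q := fun i => by
    obtain ⟨lam, h⟩ := hbT i
    refine ⟨lam, fun p q => ?_⟩
    rw [← h, hinner, Matrix.mul_assoc]
    rfl
  have hdet : L.det = 1 ∨ L.det = -1 := by
    have h := congrArg Matrix.det hLL
    rw [det_mul, det_transpose, det_one] at h
    exact mul_self_eq_one_iff.1 h
  rcases hdet with hdet | hdet
  · refine ⟨L, (Matrix.mem_orthogonalGroup_iff' _ _).2 hLL, hdet, fun i => ?_⟩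
    obtain ⟨lam, h⟩ := hLA i
    exact ⟨lam, Matrix.ext h⟩
  · obtain _ | n := N
    · simp at hdet
      norm_num at hdet
    let d : Fin (n + 1) → ℝ := fun p => if p = 0 then -1 else 1
    have hd : diagonal d * diagonal d = 1 := by
      rw [diagonal_mul_diagonal, ← diagonal_one]
      congr 1
      ext p
      by_cases hp : p = 0 <;> simp [d, hp]
    refine ⟨L * diagonal d, (Matrix.mem_orthogonalGroup_iff' _ _).2 ?_, ?_, fun i => ?_⟩
    · rw [transpose_mul, diagonal_transpose, Matrix.mul_assoc, ← Matrix.mul_assoc Lᵀ, hLL,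
        Matrix.one_mul, hd]
    · rw [det_mul, det_diagonal, hdet, Fin.prod_univ_succ]
      simp [d]
    · obtain ⟨lam, h⟩ := hLA i
      refine ⟨fun j => if j = 0 then -lam j else lam j, Matrix.ext fun p q => ?_⟩
      have : (L * diagonal d)ᵀ * A i * (L * diagonal d) =
          diagonal d * (Lᵀ * A i * L) * diagonal d := by
        rw [transpose_mul, diagonal_transpose]
        simp only [Matrix.mul_assoc]
      rw [this, mul_diagonal, diagonal_mul, h, of_apply]
      simp only [skewBlockEntry, d, Fin.ext_iff, Fin.val_zero]
      split_ifs <;> first | omega | simp
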